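/- Let k ≥ 1 be an integer and let μ be a finite signed Borel measure on the two-point compactification ℝ̄ = ℝ ∪ {−∞, +∞}. Suppose that for every a ≠ 0 and b ∈ ℝ the integral over ℝ̄ of the (unique continuous extension to ℝ̄ of the) function x ↦ ReLU^k(ax + b)/(1+|x|^k) with respect to μ vanishes. Then μ = 0. -/

import Mathlib

open MeasureTheory

open Filter Topology Set

section ReLUPowerMeasures

/-- A finite measure on `EReal` is the sum of its part on the real line and two atoms. -/
theorem EReal.measure_eq_map_comap_add_dirac (μ : Measure EReal) :
    μ = (μ.comap Real.toEReal).map Real.toEReal +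
      (μ {⊤} • Measure.dirac ⊤ + μ {⊥} • Measure.dirac ⊥) := by
  have hr : MeasurableSet (range Real.toEReal) :=
    EReal.measurableEmbedding_coe.measurableSet_range
  have hc : (range Real.toEReal)ᶜ = {⊤} ∪ {⊥} := by
    ext x
    induction x <;> simp
  rw [EReal.measurableEmbedding_coe.map_comap, ← Measure.restrict_singleton,
    ← Measure.restrict_singleton, ← Measure.restrict_union (by simp) (measurableSet_singleton _),
    ← hc, Measure.restrict_add_restrict_compl hr]

theorem EReal.integral_eq_integral_comap_add (μ : Measure EReal) [IsFiniteMeasure μ]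
    {g : EReal → ℝ} (hg : Continuous g) :
    ∫ y, g y ∂μ = ∫ x : ℝ, g x ∂(μ.comap Real.toEReal) +
      (μ.real {⊤} * g ⊤ + μ.real {⊥} * g ⊥) := by
  have hi : Integrable g μ :=
    hg.integrable_of_hasCompactSupport (HasCompactSupport.of_compactSpace g)
  have key := EReal.measure_eq_map_comap_add_dirac μ
  have hi' := hi
  rw [key] at hi'
  rw [integrable_add_measure, integrable_add_measure] at hi'
  conv_lhs => rw [key]
  rw [integral_add_measure hi'.1 (integrable_add_measure.2 hi'.2),
    integral_add_measure hi'.2.1 hi'.2.2, EReal.measurableEmbedding_coe.integral_map,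
    integral_smul_measure, integral_smul_measure, integral_dirac, integral_dirac]
  rfl

/-- A continuous function on `ℝ` with limits at `±∞` extends continuously to `EReal`. -/
theorem EReal.exists_continuous_extension {f : ℝ → ℝ} (hf : Continuous f) {A B : ℝ}
    (hA : Tendsto f atTop (𝓝 A)) (hB : Tendsto f atBot (𝓝 B)) :
    ∃ g : EReal → ℝ, Continuous g ∧ (∀ x : ℝ, g x = f x) ∧ g ⊤ = A ∧ g ⊥ = B := by
  refine ⟨fun y => EReal.rec B f A y, ?_, fun _ => rfl, rfl, rfl⟩
  rw [continuous_iff_continuousAt]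
  intro y
  induction y with
  | bot =>
    rw [continuousAt_iff_punctured_nhds, EReal.nhdsWithin_bot, tendsto_map'_iff]
    exact hB
  | top =>
    rw [continuousAt_iff_punctured_nhds, EReal.nhdsWithin_top, tendsto_map'_iff]
    exact hA
  | coe x =>
    rw [ContinuousAt, EReal.nhds_coe, tendsto_map'_iff]
    exact hf.continuousAt

theorem continuous_ReLU_pow_div (k : ℕ) (a b : ℝ) :
    Continuous fun x : ℝ => max (a * x + b) 0 ^ k / (1 + |x| ^ k) := by
  refine Continuous.div (by fun_prop) (by fun_prop) fun x => ?_
  positivity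

theorem tendsto_ReLU_pow_div_atTop {k : ℕ} (hk : 1 ≤ k) (b : ℝ) :
    Tendsto (fun x : ℝ => max (x + b) 0 ^ k / (1 + |x| ^ k)) atTop (𝓝 1) := by
  have h1 : Tendsto (fun x : ℝ => (1 + b * x⁻¹) ^ k / (x⁻¹ ^ k + 1)) atTop (𝓝 1) := by
    have hi := tendsto_inv_atTop_zero (𝕜 := ℝ)
    have := (((hi.const_mul b).const_add 1).pow k).div ((hi.pow k).add_const 1)
      (by simp [show k ≠ 0 by omega])
    simpa [show k ≠ 0 by omega, Pi.div_def] using this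
  refine h1.congr' ?_
  filter_upwards [eventually_gt_atTop 0, eventually_gt_atTop (-b)] with x hx hb
  rw [max_eq_left (by linarith), abs_of_pos hx]
  have : x + b = x * (1 + b * x⁻¹) := by field_simp
  rw [this, mul_pow, inv_pow]
  have : x ^ k ≠ 0 := by positivity
  field_simp

theorem tendsto_ReLU_pow_div_atBot {k : ℕ} (hk : 1 ≤ k) (b : ℝ) :
    Tendsto (fun x : ℝ => max (x + b) 0 ^ k / (1 + |x| ^ k)) atBot (𝓝 0) := by
  refine tendsto_const_nhds.congr' ?_
  filter_upwards [eventually_lt_atBot (-b)] with x hx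
  rw [max_eq_right (by linarith), zero_pow (by omega), zero_div]

/-- The truncated power `(x - t)₊ ^ j`, which for `j = 0` is the indicator of `x > t`. -/
noncomputable def truncPow (j : ℕ) (t x : ℝ) : ℝ := if t < x then (x - t) ^ j else 0

theorem truncPow_eq_max {j : ℕ} (hj : j ≠ 0) (t x : ℝ) :
    truncPow j t x = max (x - t) 0 ^ j := by
  unfold truncPow
  split_ifs with h
  · rw [max_eq_left (by linarith)]
  · rw [max_eq_right (by linarith), zero_pow hj]

theorem measurable_truncPow (j : ℕ) (t : ℝ) : Measurable (truncPow j t) :=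
  Measurable.ite measurableSet_Ioi (by fun_prop) measurable_const

theorem truncPow_nonneg (j : ℕ) (t x : ℝ) : 0 ≤ truncPow j t x := by
  unfold truncPow
  split_ifs with h
  · exact pow_nonneg (by linarith) _
  · exact le_rfl

theorem truncPow_le {j k : ℕ} (hj : j ≤ k) (t x : ℝ) :
    truncPow j t x ≤ ((1 + |t|) ^ k * 2 ^ (k - 1)) * (1 + |x| ^ k) := by
  unfold truncPow
  split_ifs with h
  · calc (x - t) ^ j ≤ ((1 + |t|) * (1 + |x|)) ^ j := by
          refine pow_le_pow_left₀ (by linarith) ?_ j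
          nlinarith [le_abs_self x, neg_abs_le t, abs_nonneg x, abs_nonneg t,
            mul_nonneg (abs_nonneg x) (abs_nonneg t)]
      _ ≤ ((1 + |t|) * (1 + |x|)) ^ k := by
          refine pow_le_pow_right₀ ?_ hj
          nlinarith [abs_nonneg x, abs_nonneg t, mul_nonneg (abs_nonneg x) (abs_nonneg t)]
      _ = (1 + |t|) ^ k * (1 + |x|) ^ k := mul_pow _ _ _
      _ ≤ (1 + |t|) ^ k * (2 ^ (k - 1) * (1 ^ k + |x| ^ k)) := by
          gcongr
          exact add_pow_le zero_le_one (abs_nonneg x) k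
      _ = _ := by rw [one_pow, mul_assoc]
  · positivity

theorem integrable_truncPow_div {j k : ℕ} (hj : j ≤ k) (t : ℝ) (ρ : Measure ℝ)
    [IsFiniteMeasure ρ] : Integrable (fun x => truncPow j t x / (1 + |x| ^ k)) ρ := by
  refine Integrable.of_bound (C := (1 + |t|) ^ k * 2 ^ (k - 1))
    (((measurable_truncPow j t).div (by fun_prop)).aestronglyMeasurable) ?_
  refine Eventually.of_forall fun x => ?_
  have hx : 0 < 1 + |x| ^ k := by positivity
  rw [Real.norm_eq_abs, abs_of_nonneg (div_nonneg (truncPow_nonneg _ _ _) hx.le), div_le_iff₀ hx]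
  exact truncPow_le hj t x

theorem abs_truncPow_sub_le (j : ℕ) {t h : ℝ} (hh : 0 < h) (x : ℝ) :
    |truncPow (j + 1) t x - truncPow (j + 1) (t + h) x| ≤ h * ((j + 1) * truncPow j t x) := by
  by_cases hx : t < x
  · rw [truncPow_eq_max j.succ_ne_zero, truncPow_eq_max j.succ_ne_zero]
    have h0 : truncPow j t x = (x - t) ^ j := if_pos hx
    have hle : max (x - (t + h)) 0 ≤ x - t := max_le (by linarith) (by linarith)
    have hge : x - (t + h) ≤ max (x - (t + h)) 0 := le_max_left _ _
    have hge0 : 0 ≤ max (x - (t + h)) 0 := le_max_right _ _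
    rw [max_eq_left (a := x - t) (by linarith), h0]
    refine (abs_pow_sub_pow_le _ _ _).trans ?_
    rw [abs_of_nonneg (a := x - t) (by linarith), abs_of_nonneg hge0, max_eq_left hle,
      abs_of_nonneg (by linarith), mul_assoc]
    push_cast
    have : 0 ≤ ((j : ℝ) + 1) * (x - t) ^ j :=
      mul_nonneg (by positivity) (pow_nonneg (by linarith) _)
    exact mul_le_mul_of_nonneg_right (by linarith) this
  · have hx' : ¬ t + h < x := by linarith
    simp [truncPow, hx, hx']

theorem tendsto_truncPow_slope (j : ℕ) (t x : ℝ) :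
    Tendsto (fun h : ℝ => h⁻¹ * (truncPow (j + 1) t x - truncPow (j + 1) (t + h) x))
      (𝓝[>] 0) (𝓝 ((j + 1) * truncPow j t x)) := by
  by_cases hx : t < x
  · have hd : HasDerivAt (fun s : ℝ => -(x - s) ^ (j + 1)) ((j + 1) * (x - t) ^ j) t := by
      have : HasDerivAt (fun s : ℝ => -(x - s) ^ (j + 1)) _ t :=
        (((hasDerivAt_id t).const_sub x).pow (j + 1)).neg
      simpa using this
    have hs := hd.tendsto_slope_zero.mono_left (nhdsGT_le_nhdsNE 0)
    have h0 : truncPow j t x = (x - t) ^ j := if_pos hx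
    rw [h0]
    refine hs.congr' ?_
    have hlt : ∀ᶠ h : ℝ in 𝓝[>] 0, h < x - t :=
      (eventually_lt_nhds (by linarith)).filter_mono nhdsWithin_le_nhds
    filter_upwards [hlt] with h hh
    have h2 : t + h < x := by linarith
    simp only [truncPow, hx, h2, if_true, smul_eq_mul]
    ring
  · refine tendsto_const_nhds.congr' ?_
    filter_upwards [self_mem_nhdsWithin] with h hh
    have hh : 0 < h := hh
    have hx' : ¬ t + h < x := by linarith
    simp [truncPow, hx, hx']

theorem tendsto_integral_truncPow_slope {j k : ℕ} (hj : j + 1 ≤ k) (t : ℝ) (ρ : Measure ℝ)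
    [IsFiniteMeasure ρ] :
    Tendsto (fun h : ℝ => h⁻¹ * (∫ x, truncPow (j + 1) t x / (1 + |x| ^ k) ∂ρ -
        ∫ x, truncPow (j + 1) (t + h) x / (1 + |x| ^ k) ∂ρ))
      (𝓝[>] 0) (𝓝 ((j + 1) * ∫ x, truncPow j t x / (1 + |x| ^ k) ∂ρ)) := by
  have hlim : Tendsto (fun h : ℝ => ∫ x, h⁻¹ * (truncPow (j + 1) t x / (1 + |x| ^ k) -
        truncPow (j + 1) (t + h) x / (1 + |x| ^ k)) ∂ρ) (𝓝[>] 0)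
      (𝓝 (∫ x, (j + 1) * (truncPow j t x / (1 + |x| ^ k)) ∂ρ)) := by
    refine tendsto_integral_filter_of_dominated_convergence
      (fun x => (j + 1) * (truncPow j t x / (1 + |x| ^ k))) ?_ ?_ ?_ ?_
    · refine Eventually.of_forall fun h => ?_
      exact (((integrable_truncPow_div hj t ρ).sub
        (integrable_truncPow_div hj (t + h) ρ)).const_mul _).aestronglyMeasurable
    · filter_upwards [self_mem_nhdsWithin] with h hh
      have hh : 0 < h := hh
      refine Eventually.of_forall fun x => ?_
      have hx : 0 < 1 + |x| ^ k := by positivity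
      rw [← sub_div, Real.norm_eq_abs, abs_mul, abs_div, abs_of_pos hx, abs_of_pos (inv_pos.2 hh),
        ← mul_div_assoc, ← mul_div_assoc]
      refine div_le_div_of_nonneg_right ?_ hx.le
      rw [inv_mul_le_iff₀ hh]
      exact abs_truncPow_sub_le j hh x
    · exact (integrable_truncPow_div (by omega) t ρ).const_mul _
    · refine Eventually.of_forall fun x => ?_
      have := (tendsto_truncPow_slope j t x).div_const (1 + |x| ^ k)
      rw [mul_div_assoc] at this
      refine this.congr fun h => ?_
      ring
  rw [integral_const_mul] at hlim
  refine hlim.congr fun h => ?_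
  rw [integral_const_mul, integral_sub (integrable_truncPow_div hj t ρ)
    (integrable_truncPow_div hj (t + h) ρ)]

theorem integral_truncPow_eq_of_succ {j k : ℕ} (hj : j + 1 ≤ k) (ρ₁ ρ₂ : Measure ℝ)
    [IsFiniteMeasure ρ₁] [IsFiniteMeasure ρ₂] (c : ℝ)
    (H : ∀ t, ∫ x, truncPow (j + 1) t x / (1 + |x| ^ k) ∂ρ₁ =
      ∫ x, truncPow (j + 1) t x / (1 + |x| ^ k) ∂ρ₂ + c) (t : ℝ) :
    ∫ x, truncPow j t x / (1 + |x| ^ k) ∂ρ₁ = ∫ x, truncPow j t x / (1 + |x| ^ k) ∂ρ₂ := by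
  have h₁ := tendsto_integral_truncPow_slope hj t ρ₁
  have h₂ := tendsto_integral_truncPow_slope hj t ρ₂
  simp only [H, add_sub_add_right_eq_sub] at h₁
  exact mul_left_cancel₀ (by positivity) (tendsto_nhds_unique h₁ h₂)

theorem integral_truncPow_zero_eq {k : ℕ} (hk : 1 ≤ k) (ρ₁ ρ₂ : Measure ℝ)
    [IsFiniteMeasure ρ₁] [IsFiniteMeasure ρ₂] (c : ℝ)
    (H : ∀ t, ∫ x, truncPow k t x / (1 + |x| ^ k) ∂ρ₁ =
      ∫ x, truncPow k t x / (1 + |x| ^ k) ∂ρ₂ + c) (t : ℝ) :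
    ∫ x, truncPow 0 t x / (1 + |x| ^ k) ∂ρ₁ = ∫ x, truncPow 0 t x / (1 + |x| ^ k) ∂ρ₂ := by
  obtain ⟨m, rfl⟩ : ∃ m, k = m + 1 := ⟨k - 1, by omega⟩
  have key : ∀ i ≤ m, ∀ t, ∫ x, truncPow (m - i) t x / (1 + |x| ^ (m + 1)) ∂ρ₁ =
      ∫ x, truncPow (m - i) t x / (1 + |x| ^ (m + 1)) ∂ρ₂ := by
    intro i
    induction i with
    | zero => exact fun _ => integral_truncPow_eq_of_succ le_rfl ρ₁ ρ₂ c H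
    | succ i ih =>
      intro hi
      refine integral_truncPow_eq_of_succ (by omega) ρ₁ ρ₂ 0 fun t => ?_
      rw [show m - (i + 1) + 1 = m - i by omega, add_zero]
      exact ih (by omega) t
  simpa using key m le_rfl t

/-- Finite measures on `ℝ` with equal weighted truncated moments, up to a constant, are equal. -/
theorem measure_eq_of_integral_truncPow_eq {k : ℕ} (hk : 1 ≤ k) (ρ₁ ρ₂ : Measure ℝ)
    [IsFiniteMeasure ρ₁] [IsFiniteMeasure ρ₂] (c : ℝ)
    (H : ∀ t, ∫ x, truncPow k t x / (1 + |x| ^ k) ∂ρ₁ =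
      ∫ x, truncPow k t x / (1 + |x| ^ k) ∂ρ₂ + c) : ρ₁ = ρ₂ := by
  set w : ℝ → ENNReal := fun x => ENNReal.ofReal (1 / (1 + |x| ^ k)) with hw
  have hwm : Measurable w := by fun_prop
  have hIoi : ∀ (ρ : Measure ℝ) [IsFiniteMeasure ρ] (t : ℝ), ρ.withDensity w (Ioi t) =
      ENNReal.ofReal (∫ x, truncPow 0 t x / (1 + |x| ^ k) ∂ρ) := by
    intro ρ _ t
    rw [withDensity_apply _ measurableSet_Ioi, ← lintegral_indicator measurableSet_Ioi,
      ofReal_integral_eq_lintegral_ofReal (integrable_truncPow_div (Nat.zero_le k) t ρ)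
        (Eventually.of_forall fun x => div_nonneg (truncPow_nonneg _ _ _) (by positivity))]
    refine lintegral_congr fun x => ?_
    by_cases hx : t < x <;> simp [truncPow, hw, hx]
  have hIoi_eq : ∀ t, ρ₁.withDensity w (Ioi t) = ρ₂.withDensity w (Ioi t) := fun t => by
    rw [hIoi, hIoi, integral_truncPow_zero_eq hk ρ₁ ρ₂ c H t]
  have hIoi_ne : ∀ (ρ : Measure ℝ) [IsFiniteMeasure ρ] (t : ℝ),
      ρ.withDensity w (Ioi t) ≠ ⊤ := fun ρ _ t => by
    rw [hIoi]
    exact ENNReal.ofReal_ne_top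
  have hIoc : ∀ (ρ : Measure ℝ) [IsFiniteMeasure ρ] (a b : ℝ), a < b →
      ρ.withDensity w (Ioc a b) = ρ.withDensity w (Ioi a) - ρ.withDensity w (Ioi b) := by
    intro ρ _ a b hab
    rw [← Ioi_sdiff_Ioi, measure_sdiff (Ioi_subset_Ioi hab.le)
      measurableSet_Ioi.nullMeasurableSet (hIoi_ne ρ b)]
  have hd : ρ₁.withDensity w = ρ₂.withDensity w := by
    refine Measure.ext_of_Ioc' _ _ (fun a b _ => ?_) fun a b hab => ?_
    · exact ne_top_of_le_ne_top (hIoi_ne ρ₁ a) (measure_mono Ioc_subset_Ioi_self)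
    · rw [hIoc ρ₁ a b hab, hIoc ρ₂ a b hab, hIoi_eq, hIoi_eq]
  have hinv : ∀ ρ : Measure ℝ, (ρ.withDensity w).withDensity (fun x => (w x)⁻¹) = ρ := by
    intro ρ
    refine withDensity_inv_same hwm (Eventually.of_forall fun x => ?_)
      (Eventually.of_forall fun x => ENNReal.ofReal_ne_top)
    rw [hw]
    exact (ENNReal.ofReal_pos.2 (by positivity)).ne'
  rw [← hinv ρ₁, hd, hinv]

end ReLUPowerMeasures

/-- If a finite signed Borel measure on the two-point compactification
`ℝ̄ = ℝ ∪ {−∞, +∞}` (realized as `EReal`, and with the signed measure encoded as a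
difference `μ₁ − μ₂` of finite Borel measures) annihilates the continuous extension
to `ℝ̄` of every function `x ↦ ReLU^k(ax+b)/(1+|x|^k)` with `a ≠ 0`, then it is zero. -/
theorem annihilating_measure_of_ReLUk_eq_zero (k : ℕ) (hk : 1 ≤ k)
    (μ₁ μ₂ : Measure EReal) [IsFiniteMeasure μ₁] [IsFiniteMeasure μ₂]
    (h : ∀ (a b : ℝ), a ≠ 0 → ∀ g : EReal → ℝ, Continuous g →
      (∀ x : ℝ, g (x : EReal) = max (a * x + b) 0 ^ k / (1 + |x| ^ k)) →
      ∫ y, g y ∂μ₁ = ∫ y, g y ∂μ₂) :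
    μ₁ = μ₂ := by
  have hfin : ∀ (μ : Measure EReal) [IsFiniteMeasure μ],
      IsFiniteMeasure (μ.comap Real.toEReal) := fun μ _ => ⟨by
    rw [EReal.measurableEmbedding_coe.comap_apply]
    exact measure_lt_top _ _⟩
  have := hfin μ₁
  have := hfin μ₂
  have htop : ∀ t : ℝ,
      ∫ x, truncPow k t x / (1 + |x| ^ k) ∂(μ₁.comap Real.toEReal) + μ₁.real {⊤} =
        ∫ x, truncPow k t x / (1 + |x| ^ k) ∂(μ₂.comap Real.toEReal) + μ₂.real {⊤} := by
    intro t
    obtain ⟨g, hg, hgx, hgt, hgb⟩ := EReal.exists_continuous_extension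
      (continuous_ReLU_pow_div k 1 (-t))
      (by simpa using tendsto_ReLU_pow_div_atTop hk (-t))
      (by simpa using tendsto_ReLU_pow_div_atBot hk (-t))
    have hm := h 1 (-t) one_ne_zero g hg hgx
    rw [EReal.integral_eq_integral_comap_add μ₁ hg, EReal.integral_eq_integral_comap_add μ₂ hg,
      hgt, hgb] at hm
    simpa [hgx, truncPow_eq_max (show k ≠ 0 by omega), sub_eq_add_neg] using hm
  have hρ : μ₁.comap Real.toEReal = μ₂.comap Real.toEReal :=
    measure_eq_of_integral_truncPow_eq hk _ _ (μ₂.real {⊤} - μ₁.real {⊤})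
      fun t => by linarith [htop t]
  have ht : μ₁ {⊤} = μ₂ {⊤} := by
    have := htop 0
    rw [hρ] at this
    exact (measureReal_eq_measureReal_iff).1 (add_left_cancel this)
  have hb : μ₁ {⊥} = μ₂ {⊥} := by
    have hneg : (fun x : ℝ => max (-1 * x + 0) 0 ^ k / (1 + |x| ^ k)) =
        (fun x : ℝ => max (x + 0) 0 ^ k / (1 + |x| ^ k)) ∘ Neg.neg := by
      ext x
      simp
    obtain ⟨g, hg, hgx, hgt, hgb⟩ := EReal.exists_continuous_extension
      (continuous_ReLU_pow_div k (-1) 0)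
      (by rw [hneg]; exact (tendsto_ReLU_pow_div_atBot hk 0).comp tendsto_neg_atTop_atBot)
      (by rw [hneg]; exact (tendsto_ReLU_pow_div_atTop hk 0).comp tendsto_neg_atBot_atTop)
    have hm := h (-1) 0 (by norm_num) g hg hgx
    rw [EReal.integral_eq_integral_comap_add μ₁ hg, EReal.integral_eq_integral_comap_add μ₂ hg,
      hgt, hgb, hρ] at hm
    exact (measureReal_eq_measureReal_iff).1 (by simpa using hm)
  rw [EReal.measure_eq_map_comap_add_dirac μ₁, EReal.measure_eq_map_comap_add_dirac μ₂, hρ, ht, hb]
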